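/- Let A be an algebra over a field k and σ : A → A a semisimple (diagonalisable) algebra automorphism, i.e., A = ⊕_{λ∈Σ} A_λ with A_λ = {a ∈ A : σ(a) = λa}. Then the para-cyclic k-vector space C_•(A,A_σ) is quasi-cyclic: for every n, C_n(A,A_σ) = ker(id − T_n) ⊕ im(id − T_n), where T_n = t_n^{n+1} = σ ⊗ σ ⊗ ⋯ ⊗ σ ((n+1) factors) on C_n(A,A_σ) = A ⊗_k A^{⊗_k n}. -/

import Mathlib

open Function

universe u

theorem isCompl_aux {k V : Type*} [Field k] [AddCommGroup V] [Module k V] (f : Module.End k V)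
    (h : (⨆ μ : k, Module.End.eigenspace f μ) = ⊤) :
    IsCompl (LinearMap.ker (LinearMap.id - f)) (LinearMap.range (LinearMap.id - f)) := by
  constructor
  · have h1 : LinearMap.ker (LinearMap.id - f) ≤ Module.End.eigenspace f 1 := by
      intro x hx
      rw [LinearMap.mem_ker, LinearMap.sub_apply, sub_eq_zero] at hx
      rw [Module.End.mem_eigenspace_iff, one_smul]
      exact hx.symm
    have h2 : LinearMap.range (LinearMap.id - f) ≤
        ⨆ μ : k, ⨆ _ : μ ≠ 1, Module.End.eigenspace f μ := by
      rw [LinearMap.range_eq_map, ← h, Submodule.map_iSup]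
      refine iSup_le fun μ => ?_
      rintro _ ⟨x, hx, rfl⟩
      have hx' := Module.End.mem_eigenspace_iff.1 hx
      have he : (LinearMap.id - f : V →ₗ[k] V) x = (1 - μ) • x := by
        rw [LinearMap.sub_apply, hx', sub_smul, one_smul, LinearMap.id_apply]
      rw [he]
      by_cases hμ : μ = 1
      · simp [hμ]
      · exact Submodule.smul_mem _ _ (Submodule.mem_iSup_of_mem μ (Submodule.mem_iSup_of_mem hμ hx))
    exact ((Module.End.eigenspaces_iSupIndep f) 1).mono h1 h2
  · rw [codisjoint_iff, eq_top_iff, ← h]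
    refine iSup_le fun μ x hx => ?_
    have hx' := Module.End.mem_eigenspace_iff.1 hx
    by_cases hμ : μ = 1
    · refine Submodule.mem_sup_left ?_
      simp [hx', hμ]
    · refine Submodule.mem_sup_right ⟨(1 - μ)⁻¹ • x, ?_⟩
      have : (1 - μ) ≠ 0 := sub_ne_zero.2 (Ne.symm hμ)
      have he : (LinearMap.id - f : V →ₗ[k] V) x = (1 - μ) • x := by
        rw [LinearMap.sub_apply, hx', sub_smul, one_smul, LinearMap.id_apply]
      rw [map_smul, he, smul_smul, inv_mul_cancel₀ this, one_smul]

theorem multilin_aux {k V W ι : Type*} [Field k] [AddCommGroup V] [Module k V]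
    [AddCommGroup W] [Module k W] [Fintype ι] [DecidableEq ι]
    (g : MultilinearMap k (fun _ : ι => V) W) (E : k → Submodule k V) (h : (⨆ μ, E μ) = ⊤)
    (P : Submodule k W) (hP : ∀ a : ι → V, (∀ i, ∃ μ, a i ∈ E μ) → g a ∈ P) (a : ι → V) :
    g a ∈ P := by
  have key : ∀ s : Finset ι, ∀ a : ι → V, (∀ i, i ∉ s → ∃ μ, a i ∈ E μ) → g a ∈ P := by
    intro s
    induction s using Finset.induction_on with
    | empty => intro a ha; exact hP a fun i => ha i (by simp)
    | insert j s hj ih =>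
      intro a ha
      have hall : ∀ x : V, g (update a j x) ∈ P := by
        intro x
        have hx : x ∈ ⨆ μ, E μ := by rw [h]; trivial
        induction hx using Submodule.iSup_induction' with
        | mem μ x hx =>
          refine ih _ fun i hi => ?_
          by_cases hij : i = j
          · subst hij; exact ⟨μ, by simpa using hx⟩
          · rw [update_of_ne hij]
            exact ha i (by simp [hij, hi])
        | zero => rw [g.map_update_zero]; exact P.zero_mem
        | add x y _ _ hx hy => rw [g.map_update_add]; exact P.add_mem hx hy
      simpa using hall (a j)
  exact key Finset.univ a (by simp)

/-- Let `A` be an algebra over a field `k` and `σ : A → A` a semisimple (diagonalisable)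
algebra automorphism, i.e. `A` is the (internal) direct sum of the eigenspaces of `σ`.
Then the para-cyclic `k`-vector space `C_•(A,A_σ)` is quasi-cyclic: for every `n`,
`C_n(A,A_σ) = ker(id − T_n) ⊕ im(id − T_n)`, where
`T_n = t_n^{n+1} = σ ⊗ σ ⊗ ⋯ ⊗ σ` (`n+1` factors) on `C_n(A,A_σ) = A ⊗_k A^{⊗_k n}`. -/
theorem paracyclic_module_of_semisimple_automorphism_is_quasiCyclic
    (k : Type u) [Field k] (A : Type u) [Ring A] [Algebra k A] (σ : A ≃ₐ[k] A)
    (hss : (⨆ lam : k, Module.End.eigenspace (σ.toLinearMap : Module.End k A) lam) = ⊤) :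
    ∀ n : ℕ,
      IsCompl
        (LinearMap.ker (LinearMap.id
          - PiTensorProduct.map (fun _ : Fin (n + 1) => (σ.toLinearMap : A →ₗ[k] A))))
        (LinearMap.range (LinearMap.id
          - PiTensorProduct.map (fun _ : Fin (n + 1) => (σ.toLinearMap : A →ₗ[k] A)))) := by
  intro n
  refine isCompl_aux _ ?_
  rw [eq_top_iff, ← PiTensorProduct.span_tprod_eq_top, Submodule.span_le]
  rintro _ ⟨a, rfl⟩
  refine multilin_aux (PiTensorProduct.tprod k) _ hss _ ?_ a
  intro a ha
  choose μ hμ using ha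
  refine Submodule.mem_iSup_of_mem (∏ i, μ i) ?_
  rw [Module.End.mem_eigenspace_iff, PiTensorProduct.map_tprod, ← MultilinearMap.map_smul_univ]
  congr 1
  funext i
  exact Module.End.mem_eigenspace_iff.1 (hμ i)
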